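/- Let b₀, …, bₙ : ℝ × ℤ → Matrix (Fin r) (Fin r) ℝ, u : ℝ × ℤ → Matrix (Fin r) (Fin m) ℝ and v : ℝ × ℤ → Matrix (Fin m) (Fin r) ℝ be such that t ↦ u(t,k) and t ↦ v(t,k) are differentiable for each k ∈ ℤ, and suppose that for all (t,k): ∂_t u(t,k) = Σ_{i=0}^{n} b_i(t,k)·(Δ^i u(t,·))(k) and ∂_t v(t,k) = -Σ_{i=0}^{n} (-1)^i Δ^i(Λ⁻ⁱ(v(t,·)·b_i(t,·)))(k), where Δ and Λ act in the variable k. For each t let B_t(g) = Σ_{i=0}^{n} b_i(t,·)·Δ^i g and T_t(g) = u(t,·)·J(v(t,·)·g) on V_r. Then there exist c₀, …, c_{n-1} : ℝ × ℤ → Matrix (Fin r) (Fin r) ℝ such that for every g ∈ V_r, every t ∈ ℝ and k ∈ ℤ: ∂_t [(T_t g)(k)] = (B_t(T_t g) - T_t(B_t g))(k) - Σ_{i=0}^{n-1} c_i(t,k)·(Δ^i g)(k). (This realizes the lemma ∂_{t_l} T_Δ = [B_Δl, T_Δ]₋ for the modification operator of the additional symmetries of the discrete constrained multi-component KP hierarchy.)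 -/

import Mathlib

open Finset

/-- A sequence with values in `A` has support bounded below. -/
def SuppBddBelow {A : Type*} [Zero A] (f : ℤ → A) : Prop :=
  ∃ M : ℤ, ∀ n : ℤ, n < M → f n = 0

/-- The inverse shift operator `(Λ⁻¹ f)(n) = f(n-1)` (applied entrywise). -/
def shiftLinv {A : Type*} (f : ℤ → A) : ℤ → A := fun n => f (n - 1)

/-- The difference operator `(Δ f)(n) = f(n+1) - f(n)` (applied entrywise). -/
def Del {A : Type*} [AddCommGroup A] (f : ℤ → A) : ℤ → A := fun n => f (n + 1) - f n

/-- The summation operator `(J f)(n) = ∑_{m < n} f(m)` (a finite sum when the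
support of `f` is bounded below, realized via `finsum`; applied entrywise). -/
noncomputable def Jop {A : Type*} [AddCommMonoid A] (f : ℤ → A) : ℤ → A :=
  fun n => ∑ᶠ (m : ℤ) (_ : m < n), f m

/-- Entrywise time-derivative of a matrix-valued function of `t`. -/
noncomputable def matDeriv {p q : ℕ} (a : ℝ → Matrix (Fin p) (Fin q) ℝ) (t : ℝ) :
    Matrix (Fin p) (Fin q) ℝ :=
  Matrix.of fun i j => deriv (fun s => a s i j) t

/-- The local difference operator `B_t = Σ_{i=0}^{n} M_{b_i(t,·)}∘Δⁱ` acting on `V_r`. -/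
noncomputable def Bop {r : ℕ} (n : ℕ) (b : ℕ → ℝ → ℤ → Matrix (Fin r) (Fin r) ℝ) (t : ℝ)
    (g : ℤ → Fin r → ℝ) : ℤ → Fin r → ℝ :=
  fun k => ∑ i ∈ Finset.range (n + 1), (b i t k).mulVec (Del^[i] g k)

/-- The operator `T_t(g) = u(t,·)·J(v(t,·)·g)` acting on `V_r`. -/
noncomputable def TTop {r m : ℕ} (u : ℝ → ℤ → Matrix (Fin r) (Fin m) ℝ)
    (v : ℝ → ℤ → Matrix (Fin m) (Fin r) ℝ) (t : ℝ) (g : ℤ → Fin r → ℝ) : ℤ → Fin r → ℝ :=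
  fun k => (u t k).mulVec (Jop (fun j => (v t j).mulVec (g j)) k)

open Matrix in
/-- `L` agrees on sequences with support bounded below with a difference operator
`∑_{j < N} c_j Δʲ` whose coefficients are matrix-valued sequences. -/
def IsLocalOp {ι κ : Type*} [Fintype ι] (N : ℕ) (L : (ℤ → ι → ℝ) → ℤ → κ → ℝ) : Prop :=
  ∃ c : ℕ → ℤ → Matrix κ ι ℝ, ∀ g : ℤ → ι → ℝ, SuppBddBelow g →
    ∀ k, L g k = ∑ j ∈ Finset.range N, c j k *ᵥ Del^[j] g k

section DifferenceCalculus

open Matrix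

variable {A : Type*} {ι κ μ : Type*} [Fintype ι]

theorem SuppBddBelow.del [AddCommGroup A] {f : ℤ → A} (hf : SuppBddBelow f) :
    SuppBddBelow (Del f) := by
  obtain ⟨M, hM⟩ := hf
  exact ⟨M - 1, fun k hk => by simp [Del, hM k (by omega), hM (k + 1) (by omega)]⟩

theorem SuppBddBelow.iterate_del [AddCommGroup A] {f : ℤ → A} (hf : SuppBddBelow f) (i : ℕ) :
    SuppBddBelow (Del^[i] f) := by
  induction i generalizing f with
  | zero => exact hf
  | succ i ih => exact ih hf.del

theorem SuppBddBelow.mulVec {g : ℤ → ι → ℝ} (hg : SuppBddBelow g) (w : ℤ → Matrix κ ι ℝ) :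
    SuppBddBelow fun k => w k *ᵥ g k := by
  obtain ⟨M, hM⟩ := hg
  exact ⟨M, fun k hk => by simp [hM k hk]⟩

theorem SuppBddBelow.finset_sum [AddCommMonoid A] {σ : Type*} {s : Finset σ} {f : σ → ℤ → A}
    (hf : ∀ i ∈ s, SuppBddBelow (f i)) : SuppBddBelow fun k => ∑ i ∈ s, f i k := by
  classical
  induction s using Finset.induction_on with
  | empty => exact ⟨0, by simp⟩
  | insert a s ha ih =>
    obtain ⟨M, hM⟩ := hf a (Finset.mem_insert_self a s)
    obtain ⟨M', hM'⟩ := ih fun i hi => hf i (Finset.mem_insert_of_mem hi)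
    refine ⟨min M M', fun k hk => ?_⟩
    have hs := hM' k (by omega)
    dsimp only at hs ⊢
    rw [Finset.sum_insert ha, hM k (by omega), hs, add_zero]

theorem jop_eq_sum [AddCommMonoid A] {f : ℤ → A} {M : ℤ} (hf : ∀ l < M, f l = 0) (k : ℤ) :
    Jop f k = ∑ l ∈ Finset.Ico M k, f l := by
  unfold Jop
  refine finsum_cond_eq_sum_of_cond_iff f fun {l} hl => ?_
  have : M ≤ l := by
    by_contra h
    exact hl (hf l (by omega))
  simp [this]

theorem jop_add [AddCommMonoid A] {f g : ℤ → A} (hf : SuppBddBelow f) (hg : SuppBddBelow g)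
    (k : ℤ) : Jop (fun l => f l + g l) k = Jop f k + Jop g k := by
  obtain ⟨M, hM⟩ := hf
  obtain ⟨M', hM'⟩ := hg
  rw [jop_eq_sum (M := min M M') (fun l hl => hM l (by omega)),
    jop_eq_sum (M := min M M') (fun l hl => hM' l (by omega)), ← Finset.sum_add_distrib]
  exact jop_eq_sum (fun l hl => by rw [hM l (by omega), hM' l (by omega), add_zero]) k

theorem jop_finset_sum [AddCommMonoid A] {σ : Type*} {s : Finset σ} {f : σ → ℤ → A}
    (hf : ∀ i ∈ s, SuppBddBelow (f i)) (k : ℤ) :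
    Jop (fun l => ∑ i ∈ s, f i l) k = ∑ i ∈ s, Jop (f i) k := by
  classical
  induction s using Finset.induction_on with
  | empty => simp [Jop]
  | insert a s ha ih =>
    have hs : ∀ i ∈ s, SuppBddBelow (f i) := fun i hi => hf i (Finset.mem_insert_of_mem hi)
    simp only [Finset.sum_insert ha]
    rw [jop_add (hf a (Finset.mem_insert_self a s)) (SuppBddBelow.finset_sum hs), ih hs]

theorem jop_smul {R : Type*} [Semiring R] [AddCommMonoid A] [Module R A] {f : ℤ → A}
    (hf : SuppBddBelow f) (c : R) (k : ℤ) :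
    Jop (fun l => c • f l) k = c • Jop f k := by
  obtain ⟨M, hM⟩ := hf
  rw [jop_eq_sum hM, Finset.smul_sum]
  exact jop_eq_sum (fun l hl => by rw [hM l hl, smul_zero]) k

theorem del_jop [AddCommGroup A] {f : ℤ → A} (hf : SuppBddBelow f) : Del (Jop f) = f := by
  obtain ⟨M, hM⟩ := hf
  funext k
  have h : ∀ l < min M k, f l = 0 := fun l hl => hM l (by omega)
  rw [Del, jop_eq_sum h, jop_eq_sum h, ← Finset.insert_Ico_right_eq_Ico_add_one (by omega),
    Finset.sum_insert (by simp), add_sub_cancel_right]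

theorem jop_del [AddCommGroup A] {f : ℤ → A} (hf : SuppBddBelow f) : Jop (Del f) = f := by
  obtain ⟨M, hM⟩ := hf
  have h : ∀ l < M - 1, Del f l = 0 := fun l hl => by
    simp [Del, hM l (by omega), hM (l + 1) (by omega)]
  funext k
  rcases le_total k (M - 1) with hk | hk
  · rw [jop_eq_sum h, Finset.Ico_eq_empty (by omega), Finset.sum_empty, hM k (by omega)]
  · induction k, hk using Int.leInduction with
    | base => rw [jop_eq_sum h, Finset.Ico_self, Finset.sum_empty, hM _ (by omega)]
    | succ k hk ih =>
      rw [jop_eq_sum h] at ih ⊢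
      rw [← Finset.insert_Ico_right_eq_Ico_add_one hk, Finset.sum_insert (by simp), ih, Del,
        sub_add_cancel]

theorem del_mulVec (p : ℤ → Matrix κ ι ℝ) (g : ℤ → ι → ℝ) :
    Del (fun k => p k *ᵥ g k) =
      fun k => p (k + 1) *ᵥ Del g k + Del p k *ᵥ g k := by
  funext k
  simp only [Del, mulVec_sub, sub_mulVec]
  abel

theorem iterate_del_add [AddCommGroup A] (f g : ℤ → A) (i : ℕ) :
    Del^[i] (fun k => f k + g k) = fun k => Del^[i] f k + Del^[i] g k := by
  induction i generalizing f g with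
  | zero => rfl
  | succ i ih =>
    simp only [Function.iterate_succ_apply]
    rw [← ih]
    congr 1
    funext k
    simp only [Del]
    abel

theorem commute_del_shiftLinv [AddCommGroup A] :
    Function.Commute (Del : (ℤ → A) → ℤ → A) shiftLinv := fun f => by
  funext k
  simp only [Del, shiftLinv]
  congr 2
  ring

/-- Summation by parts. -/
theorem jop_mulVec_del (w : ℤ → Matrix κ ι ℝ) {g : ℤ → ι → ℝ} (hg : SuppBddBelow g) (k : ℤ) :
    Jop (fun l => w l *ᵥ Del g l) k
      = shiftLinv w k *ᵥ g k - Jop (fun l => Del (shiftLinv w) l *ᵥ g l) k := by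
  rw [eq_sub_iff_add_eq, ← jop_add (hg.del.mulVec w) (hg.mulVec (Del (shiftLinv w)))]
  have h := congrFun (jop_del (hg.mulVec (shiftLinv w))) k
  rw [del_mulVec] at h
  simpa [shiftLinv] using h

namespace IsLocalOp

variable {N N' : ℕ} {L L' : (ℤ → ι → ℝ) → ℤ → κ → ℝ}

theorem congr (hL : IsLocalOp N L) (h : ∀ g, SuppBddBelow g → ∀ k, L' g k = L g k) :
    IsLocalOp N L' := by
  obtain ⟨c, hc⟩ := hL
  exact ⟨c, fun g hg k => (h g hg k).trans (hc g hg k)⟩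

theorem zero : IsLocalOp N fun (_ : ℤ → ι → ℝ) (_ : ℤ) => (0 : κ → ℝ) :=
  ⟨fun _ _ => 0, by simp⟩

theorem mono (hL : IsLocalOp N L) (h : N ≤ N') : IsLocalOp N' L := by
  obtain ⟨c, hc⟩ := hL
  refine ⟨fun j k => if j < N then c j k else 0, fun g hg k => ?_⟩
  rw [hc g hg, ← Finset.sum_subset (Finset.range_mono h)]
  · exact Finset.sum_congr rfl fun j hj => by simp [Finset.mem_range.1 hj]
  · intro j _ hj
    have hj' : ¬j < N := by simpa using hj
    simp [hj']

theorem add (hL : IsLocalOp N L) (hL' : IsLocalOp N L') :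
    IsLocalOp N fun g k => L g k + L' g k := by
  obtain ⟨c, hc⟩ := hL
  obtain ⟨c', hc'⟩ := hL'
  refine ⟨fun j k => c j k + c' j k, fun g hg k => ?_⟩
  simp only [hc g hg, hc' g hg, add_mulVec, Finset.sum_add_distrib]

theorem sum {σ : Type*} {s : Finset σ} {L : σ → (ℤ → ι → ℝ) → ℤ → κ → ℝ}
    (hL : ∀ i ∈ s, IsLocalOp N (L i)) : IsLocalOp N fun g k => ∑ i ∈ s, L i g k := by
  classical
  induction s using Finset.induction_on with
  | empty => simpa using zero
  | insert a s ha ih =>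
    simp only [Finset.sum_insert ha]
    exact (hL a (Finset.mem_insert_self a s)).add
      (ih fun i hi => hL i (Finset.mem_insert_of_mem hi))

theorem mulVec [Fintype κ] (hL : IsLocalOp N L) (p : ℤ → Matrix μ κ ℝ) :
    IsLocalOp N fun g k => p k *ᵥ L g k := by
  obtain ⟨c, hc⟩ := hL
  refine ⟨fun j k => p k * c j k, fun g hg k => ?_⟩
  simp only [hc g hg, ← mulVec_mulVec, mulVec_sum]

theorem neg (hL : IsLocalOp N L) : IsLocalOp N fun g k => -L g k := by
  obtain ⟨c, hc⟩ := hL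
  refine ⟨fun j k => -c j k, fun g hg k => ?_⟩
  simp only [hc g hg, neg_mulVec, Finset.sum_neg_distrib]

theorem sub (hL : IsLocalOp N L) (hL' : IsLocalOp N L') :
    IsLocalOp N fun g k => L g k - L' g k := by
  simpa only [sub_eq_add_neg] using hL.add hL'.neg

theorem comp_del (hL : IsLocalOp N L) : IsLocalOp (N + 1) fun g k => L (Del g) k := by
  obtain ⟨c, hc⟩ := hL
  refine ⟨fun j k => if j = 0 then 0 else c (j - 1) k, fun g hg k => ?_⟩
  simp [hc _ hg.del, Finset.sum_range_succ']

theorem mulVec_iterate_del (w : ℤ → Matrix κ ι ℝ) (i : ℕ) :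
    IsLocalOp (i + 1) fun (g : ℤ → ι → ℝ) k => w k *ᵥ Del^[i] g k := by
  refine ⟨fun j k => if j = i then w k else 0, fun g _ k => ?_⟩
  rw [Finset.sum_eq_single i] <;> simp +contextual

theorem iterate_del_mulVec (p : ℤ → Matrix κ ι ℝ) (i : ℕ) :
    IsLocalOp (i + 1) fun g k => Del^[i] (fun l => p l *ᵥ g l) k := by
  induction i generalizing p with
  | zero => exact mulVec_iterate_del p 0
  | succ i ih =>
    refine ((ih fun k => p (k + 1)).comp_del.add ((ih (Del p)).mono (Nat.le_succ _))).congr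
      fun g _ k => ?_
    rw [Function.iterate_succ_apply, del_mulVec, iterate_del_add]

/-- The terms of `Δⁱ ∘ M_u ∘ J ∘ M_v` other than `M_{Δⁱ u} ∘ J ∘ M_v` form a difference operator. -/
theorem iterate_del_mulVec_jop [Fintype κ] (u : ℤ → Matrix μ κ ℝ) (v : ℤ → Matrix κ ι ℝ) (i : ℕ) :
    IsLocalOp i fun g k => Del^[i] (fun l => u l *ᵥ Jop (fun j => v j *ᵥ g j) l) k
      - Del^[i] u k *ᵥ Jop (fun j => v j *ᵥ g j) k := by
  induction i generalizing u with
  | zero => exact zero.congr fun g _ k => sub_self _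
  | succ i ih =>
    refine ((iterate_del_mulVec (fun k => u (k + 1) * v k) i).add
      ((ih (Del u)).mono (Nat.le_succ _))).congr fun g hg k => ?_
    rw [Function.iterate_succ_apply, del_mulVec, del_jop (hg.mulVec v), iterate_del_add,
      Function.iterate_succ_apply, add_sub_assoc]
    simp only [mulVec_mulVec]

/-- Iterated summation by parts: the boundary terms form a difference operator. -/
theorem jop_mulVec_iterate_del (w : ℤ → Matrix κ ι ℝ) (i : ℕ) :
    IsLocalOp i fun g k => Jop (fun l => w l *ᵥ Del^[i] g l) k
      - (-1 : ℝ) ^ i • Jop (fun l => Del^[i] (shiftLinv^[i] w) l *ᵥ g l) k := by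
  induction i generalizing w with
  | zero => exact zero.congr fun g _ k => by simp
  | succ i ih =>
    refine ((mulVec_iterate_del (shiftLinv w) i).sub
      ((ih (Del (shiftLinv w))).mono (Nat.le_succ _))).congr fun g hg k => ?_
    have hcomm : shiftLinv^[i] (Del (shiftLinv w)) = Del (shiftLinv^[i + 1] w) := by
      rw [Function.iterate_succ_apply]
      exact ((commute_del_shiftLinv.iterate_right i) (shiftLinv w)).symm
    simp only [Function.iterate_succ_apply' Del i g]
    rw [jop_mulVec_del w (hg.iterate_del i), hcomm, ← Function.iterate_succ_apply Del, pow_succ]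
    module

end IsLocalOp

end DifferenceCalculus

open Matrix in
/-- Leibniz rule for `t ↦ (T_t g)(k)`. -/
theorem deriv_TTop {r m : ℕ} {u : ℝ → ℤ → Matrix (Fin r) (Fin m) ℝ}
    {v : ℝ → ℤ → Matrix (Fin m) (Fin r) ℝ}
    (hu : ∀ (k : ℤ) (i : Fin r) (j : Fin m), Differentiable ℝ fun t => u t k i j)
    (hv : ∀ (k : ℤ) (i : Fin m) (j : Fin r), Differentiable ℝ fun t => v t k i j)
    {g : ℤ → Fin r → ℝ} (hg : SuppBddBelow g) (t : ℝ) (k : ℤ) (i : Fin r) :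
    deriv (fun s => TTop u v s g k i) t
      = (matDeriv (fun s => u s k) t *ᵥ Jop (fun l => v t l *ᵥ g l) k
          + u t k *ᵥ Jop (fun l => matDeriv (fun s => v s l) t *ᵥ g l) k) i := by
  obtain ⟨M, hM⟩ := hg
  have hJ : ∀ w : ℤ → Matrix (Fin m) (Fin r) ℝ,
      Jop (fun l => w l *ᵥ g l) k = ∑ l ∈ Finset.Ico M k, w l *ᵥ g l := fun w =>
    jop_eq_sum (fun l hl => by rw [hM l hl, mulVec_zero]) k
  simp only [TTop, hJ, Pi.add_apply, Matrix.mulVec, dotProduct, Finset.sum_apply, matDeriv,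
    Matrix.of_apply, ← Finset.sum_add_distrib]
  refine HasDerivAt.deriv (HasDerivAt.fun_sum fun j _ => ((hu k i j) t).hasDerivAt.mul ?_)
  exact HasDerivAt.fun_sum fun l _ => HasDerivAt.fun_sum fun a _ =>
    ((hv l j a) t).hasDerivAt.mul_const (g l a)

/-- if `u` and `v` evolve by `∂_t u = Σ b_i·Δⁱu` and
`∂_t v = -Σ (-1)ⁱΔⁱ(Λ⁻ⁱ(v·b_i))`, then there exist `c₀,…,c_{n-1}` such that
`∂_t[(T_t g)(k)] = (B_t(T_t g) - T_t(B_t g))(k) - Σ_{i=0}^{n-1} c_i(t,k)·(Δⁱg)(k)`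
for every `g ∈ V_r`. -/
theorem stmt10 {r m n : ℕ} (b : ℕ → ℝ → ℤ → Matrix (Fin r) (Fin r) ℝ)
    (u : ℝ → ℤ → Matrix (Fin r) (Fin m) ℝ) (v : ℝ → ℤ → Matrix (Fin m) (Fin r) ℝ)
    (hu : ∀ (k : ℤ) (i : Fin r) (j : Fin m), Differentiable ℝ fun t => u t k i j)
    (hv : ∀ (k : ℤ) (i : Fin m) (j : Fin r), Differentiable ℝ fun t => v t k i j)
    (hueq : ∀ (t : ℝ) (k : ℤ),
      matDeriv (fun s => u s k) t
        = ∑ i ∈ Finset.range (n + 1), b i t k * Del^[i] (u t) k)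
    (hveq : ∀ (t : ℝ) (k : ℤ),
      matDeriv (fun s => v s k) t
        = -∑ i ∈ Finset.range (n + 1),
            ((-1 : ℝ) ^ i) • Del^[i] (shiftLinv^[i] (fun j => v t j * b i t j)) k) :
    ∃ c : ℕ → ℝ → ℤ → Matrix (Fin r) (Fin r) ℝ,
      ∀ g : ℤ → Fin r → ℝ, SuppBddBelow g → ∀ (t : ℝ) (k : ℤ) (i : Fin r),
        deriv (fun s => TTop u v s g k i) t
          = (Bop n b t (TTop u v t g) k - TTop u v t (Bop n b t g) k
              - ∑ j ∈ Finset.range n, (c j t k).mulVec (Del^[j] g k)) i := by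
  have key : ∀ t, IsLocalOp n fun g k => Bop n b t (TTop u v t g) k - TTop u v t (Bop n b t g) k
      - (matDeriv (fun s => u s k) t).mulVec (Jop (fun l => (v t l).mulVec (g l)) k)
      - (u t k).mulVec (Jop (fun l => (matDeriv (fun s => v s l) t).mulVec (g l)) k) := by
    intro t
    have hB : IsLocalOp n fun g k => ∑ i ∈ Finset.range (n + 1), (b i t k).mulVec
        (Del^[i] (TTop u v t g) k
          - (Del^[i] (u t) k).mulVec (Jop (fun l => (v t l).mulVec (g l)) k)) :=
      IsLocalOp.sum fun i hi => ((IsLocalOp.iterate_del_mulVec_jop (u t) (v t) i).mono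
        (Nat.lt_succ_iff.1 (Finset.mem_range.1 hi))).mulVec (b i t)
    have hT : IsLocalOp n fun g k => (u t k).mulVec (∑ i ∈ Finset.range (n + 1),
        (Jop (fun l => (v t l * b i t l).mulVec (Del^[i] g l)) k
          - (-1 : ℝ) ^ i • Jop (fun l => (Del^[i] (shiftLinv^[i]
              fun j => v t j * b i t j) l).mulVec (g l)) k)) :=
      (IsLocalOp.sum fun i hi => (IsLocalOp.jop_mulVec_iterate_del
        (fun j => v t j * b i t j) i).mono (Nat.lt_succ_iff.1 (Finset.mem_range.1 hi))).mulVec (u t)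
    refine (hB.sub hT).congr fun g hg k => ?_
    have hTB : TTop u v t (Bop n b t g) k = (u t k).mulVec (∑ i ∈ Finset.range (n + 1),
        Jop (fun l => (v t l * b i t l).mulVec (Del^[i] g l)) k) := by
      rw [← jop_finset_sum fun i _ => (hg.iterate_del i).mulVec fun l => v t l * b i t l]
      simp only [TTop, Bop, Matrix.mulVec_sum, Matrix.mulVec_mulVec]
    have hvg : Jop (fun l => (matDeriv (fun s => v s l) t).mulVec (g l)) k
        = -∑ i ∈ Finset.range (n + 1), (-1 : ℝ) ^ i • Jop (fun l => (Del^[i] (shiftLinv^[i]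
              fun j => v t j * b i t j) l).mulVec (g l)) k := by
      have hs : ∀ i ∈ Finset.range (n + 1), SuppBddBelow fun l => (-(-1 : ℝ) ^ i) •
          (Del^[i] (shiftLinv^[i] fun j => v t j * b i t j) l).mulVec (g l) := fun i _ => by
        simpa only [Matrix.smul_mulVec] using hg.mulVec fun l => (-(-1 : ℝ) ^ i) •
          Del^[i] (shiftLinv^[i] fun j => v t j * b i t j) l
      rw [← Finset.sum_neg_distrib]
      simp only [← neg_smul]
      simp only [← jop_smul (hg.mulVec _)]
      rw [← jop_finset_sum hs]
      simp only [hveq, Matrix.neg_mulVec, Matrix.sum_mulVec, Matrix.smul_mulVec, neg_smul,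
        Finset.sum_neg_distrib]
    rw [hTB, hvg, hueq]
    simp only [Bop, Matrix.mulVec_sub, Matrix.mulVec_neg, Finset.sum_sub_distrib,
      Matrix.sum_mulVec, Matrix.mulVec_mulVec]
    abel
  choose c hc using key
  refine ⟨fun j t => c t j, fun g hg t k i => ?_⟩
  rw [deriv_TTop hu hv hg, ← hc t g hg k]
  refine congrFun ?_ i
  dsimp only
  abel
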